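/- arXiv:nlin/0511012 — 2 statements merged into one kernel-verified Lean document; each statement's English description precedes it below -/
import Mathlib

section
/- Let (w,u,v) be a smooth solution of the dB system and let (ψ^w, ψ^u, ψ^v) be a cosymmetry characteristic along (w,u,v). Then the triple H₄,₁ψ with components φ^w = (2w·∂_x ψ^w + 3u·∂_x ψ^u + 4v·∂_x ψ^v + u_x·ψ^u + 2v_x·ψ^v)/2, φ^u = (3u·∂_x ψ^w + 2(w² + 2v)·∂_x ψ^u − 11w·u·∂_x ψ^v + (w·w_x + v_x)·ψ^u − 2(w·u_x + 4u·w_x)·ψ^v)/2, φ^v = (4v·∂_x ψ^w − 11w·u·∂_x ψ^u − (6w³ + 16wv + 3u²)·∂_x ψ^v + (−3w·u_x − u·w_x)·ψ^u − 2(3w²·w_x + 2w·v_x + u·u_x + 4v·w_x)·ψ^v)/2 is a symmetry characteristic along (w,u,v). -/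
/-- Partial derivative with respect to the first variable `x`. -/
noncomputable def pdx (f : ℝ → ℝ → ℝ) (x t : ℝ) : ℝ := deriv (fun x' => f x' t) x

/-- Partial derivative with respect to the second variable `t`. -/
noncomputable def pdt (f : ℝ → ℝ → ℝ) (x t : ℝ) : ℝ := deriv (fun t' => f x t') t

/-- A function of two real variables is smooth. -/
def Smooth2 (f : ℝ → ℝ → ℝ) : Prop := ContDiff ℝ (⊤ : ℕ∞) (Function.uncurry f)

/-- The dispersionless Boussinesq (dB) system:
`w_t = u_x`, `u_t = w·w_x + v_x`, `v_t = −u·w_x − 3w·u_x`. -/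
def IsDBSolution (w u v : ℝ → ℝ → ℝ) : Prop :=
  (∀ x t, pdt w x t = pdx u x t) ∧
  (∀ x t, pdt u x t = w x t * pdx w x t + pdx v x t) ∧
  (∀ x t, pdt v x t = -(u x t * pdx w x t) - 3 * w x t * pdx u x t)

/-- A symmetry characteristic of the dB system along the solution `(w,u,v)`:
a solution of the linearized system. -/
def IsSymmetryChar (w u v φw φu φv : ℝ → ℝ → ℝ) : Prop :=
  (∀ x t, pdt φw x t = pdx φu x t) ∧
  (∀ x t, pdt φu x t = w x t * pdx φw x t + pdx w x t * φw x t + pdx φv x t) ∧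
  (∀ x t, pdt φv x t = -(u x t * pdx φw x t) - 3 * pdx u x t * φw x t
      - 3 * w x t * pdx φu x t - pdx w x t * φu x t)

/-- A cosymmetry characteristic of the dB system along the solution `(w,u,v)`:
a solution of the adjoint linearized system. -/
def IsCosymmetryChar (w u _v ψw ψu ψv : ℝ → ℝ → ℝ) : Prop :=
  (∀ x t, pdt ψw x t = w x t * pdx ψu x t - u x t * pdx ψv x t
      + 2 * pdx u x t * ψv x t) ∧
  (∀ x t, pdt ψu x t = pdx ψw x t - 3 * w x t * pdx ψv x t - 2 * pdx w x t * ψv x t) ∧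
  (∀ x t, pdt ψv x t = pdx ψu x t)


/-- `x`-derivative of a smooth function as a Fréchet derivative. -/
lemma hasDerivAt_pdx_aux {f : ℝ → ℝ → ℝ} (hf : Smooth2 f) (x t : ℝ) :
    HasDerivAt (fun x' => f x' t) (fderiv ℝ (Function.uncurry f) (x, t) (1, 0)) x := by
  have h1 : HasFDerivAt (Function.uncurry f) (fderiv ℝ (Function.uncurry f) (x, t)) (x, t) :=
    (hf.differentiable (by simp) (x, t)).hasFDerivAt
  have h2 : HasDerivAt (fun x' : ℝ => (x', t)) ((1 : ℝ), (0 : ℝ)) x :=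
    (hasDerivAt_id x).prodMk (hasDerivAt_const x t)
  exact h1.comp_hasDerivAt x h2

lemma hasDerivAt_pdt_aux {f : ℝ → ℝ → ℝ} (hf : Smooth2 f) (x t : ℝ) :
    HasDerivAt (fun t' => f x t') (fderiv ℝ (Function.uncurry f) (x, t) (0, 1)) t := by
  have h1 : HasFDerivAt (Function.uncurry f) (fderiv ℝ (Function.uncurry f) (x, t)) (x, t) :=
    (hf.differentiable (by simp) (x, t)).hasFDerivAt
  have h2 : HasDerivAt (fun t' : ℝ => (x, t')) ((0 : ℝ), (1 : ℝ)) t :=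
    (hasDerivAt_const t x).prodMk (hasDerivAt_id t)
  exact h1.comp_hasDerivAt t h2

lemma pdx_eq_fderiv {f : ℝ → ℝ → ℝ} (hf : Smooth2 f) (x t : ℝ) :
    pdx f x t = fderiv ℝ (Function.uncurry f) (x, t) (1, 0) :=
  (hasDerivAt_pdx_aux hf x t).deriv

lemma pdt_eq_fderiv {f : ℝ → ℝ → ℝ} (hf : Smooth2 f) (x t : ℝ) :
    pdt f x t = fderiv ℝ (Function.uncurry f) (x, t) (0, 1) :=
  (hasDerivAt_pdt_aux hf x t).deriv

lemma hasDerivAt_pdx {f : ℝ → ℝ → ℝ} (hf : Smooth2 f) (x t : ℝ) :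
    HasDerivAt (fun x' => f x' t) (pdx f x t) x := by
  rw [pdx_eq_fderiv hf]; exact hasDerivAt_pdx_aux hf x t

lemma hasDerivAt_pdt {f : ℝ → ℝ → ℝ} (hf : Smooth2 f) (x t : ℝ) :
    HasDerivAt (fun t' => f x t') (pdt f x t) t := by
  rw [pdt_eq_fderiv hf]; exact hasDerivAt_pdt_aux hf x t

lemma smooth_fderiv {f : ℝ → ℝ → ℝ} (hf : Smooth2 f) :
    ContDiff ℝ (⊤ : ℕ∞) (fderiv ℝ (Function.uncurry f)) :=
  ContDiff.fderiv_right (n := ((⊤ : ℕ∞) : WithTop ℕ∞)) hf (by simp)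

lemma uncurry_pdx {f : ℝ → ℝ → ℝ} (hf : Smooth2 f) :
    Function.uncurry (pdx f) = fun p => fderiv ℝ (Function.uncurry f) p (1, 0) := by
  funext ⟨x, t⟩
  exact pdx_eq_fderiv hf x t

lemma uncurry_pdt {f : ℝ → ℝ → ℝ} (hf : Smooth2 f) :
    Function.uncurry (pdt f) = fun p => fderiv ℝ (Function.uncurry f) p (0, 1) := by
  funext ⟨x, t⟩
  exact pdt_eq_fderiv hf x t

lemma smooth_pdx {f : ℝ → ℝ → ℝ} (hf : Smooth2 f) : Smooth2 (pdx f) := by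
  unfold Smooth2
  rw [uncurry_pdx hf]
  exact (smooth_fderiv hf).clm_apply contDiff_const

lemma smooth_pdt {f : ℝ → ℝ → ℝ} (hf : Smooth2 f) : Smooth2 (pdt f) := by
  unfold Smooth2
  rw [uncurry_pdt hf]
  exact (smooth_fderiv hf).clm_apply contDiff_const

/-- Mixed partial derivatives commute. -/
lemma pdt_pdx_comm {f : ℝ → ℝ → ℝ} (hf : Smooth2 f) (x t : ℝ) :
    pdt (pdx f) x t = pdx (pdt f) x t := by
  rw [pdt_eq_fderiv (smooth_pdx hf), pdx_eq_fderiv (smooth_pdt hf), uncurry_pdx hf,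
    uncurry_pdt hf]
  have hd : DifferentiableAt ℝ (fderiv ℝ (Function.uncurry f)) (x, t) :=
    (smooth_fderiv hf).differentiable (by simp) (x, t)
  have hs : IsSymmSndFDerivAt ℝ (Function.uncurry f) (x, t) := by
    apply ContDiffAt.isSymmSndFDerivAt (n := ((⊤ : ℕ∞) : WithTop ℕ∞)) hf.contDiffAt
    simp only [minSmoothness_of_isRCLikeNormedField]
    exact WithTop.coe_le_coe.2 (le_top : (2 : ℕ∞) ≤ ⊤)
  rw [fderiv_clm_apply hd (by fun_prop), fderiv_clm_apply hd (by fun_prop)]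
  simpa using hs.eq (0, 1) (1, 0)

lemma deriv_phi_w {w u v a b c wx ux vx ax bx cx : ℝ → ℝ} {w' u' v' a' b' c' wx' ux' vx' ax' bx' cx' s : ℝ}
    (hw : HasDerivAt w w' s)
    (hu : HasDerivAt u u' s)
    (hv : HasDerivAt v v' s)
    (ha : HasDerivAt a a' s)
    (hb : HasDerivAt b b' s)
    (hc : HasDerivAt c c' s)
    (hwx : HasDerivAt wx wx' s)
    (hux : HasDerivAt ux ux' s)
    (hvx : HasDerivAt vx vx' s)
    (hax : HasDerivAt ax ax' s)
    (hbx : HasDerivAt bx bx' s)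
    (hcx : HasDerivAt cx cx' s) :
    deriv (fun s => (2*w s*ax s+3*u s*bx s+4*v s*cx s+ux s*b s+2*vx s*c s) / 2) s =
      (((((2 * (w' * ax s + w s * ax')) + (3 * (u' * bx s + u s * bx'))) + (4 * (v' * cx s + v s * cx'))) + (ux' * b s + ux s * b')) + (2 * (vx' * c s + vx s * c'))) / 2 := by
  have key := (((((((hw.fun_mul hax).const_mul 2).fun_add ((hu.fun_mul hbx).const_mul 3)).fun_add ((hv.fun_mul hcx).const_mul 4)).fun_add (hux.fun_mul hb)).fun_add ((hvx.fun_mul hc).const_mul 2)).div_const 2)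
  refine HasDerivAt.deriv ?_
  refine (key.congr_deriv ?_).congr_of_eventuallyEq (Filter.Eventually.of_forall fun s => ?_)
  · push_cast; ring
  · simp only []; ring

lemma deriv_phi_u {w u v a b c wx ux vx ax bx cx : ℝ → ℝ} {w' u' v' a' b' c' wx' ux' vx' ax' bx' cx' s : ℝ}
    (hw : HasDerivAt w w' s)
    (hu : HasDerivAt u u' s)
    (hv : HasDerivAt v v' s)
    (ha : HasDerivAt a a' s)
    (hb : HasDerivAt b b' s)
    (hc : HasDerivAt c c' s)
    (hwx : HasDerivAt wx wx' s)
    (hux : HasDerivAt ux ux' s)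
    (hvx : HasDerivAt vx vx' s)
    (hax : HasDerivAt ax ax' s)
    (hbx : HasDerivAt bx bx' s)
    (hcx : HasDerivAt cx cx' s) :
    deriv (fun s => (3*u s*ax s+2*(w s^2+2*v s)*bx s-11*w s*u s*cx s+(w s*wx s+vx s)*b s-2*(w s*ux s+4*u s*wx s)*c s) / 2) s =
      (((((3 * (u' * ax s + u s * ax')) + (2 * (((2 * (w s)^1 * w') + (2 * v')) * bx s + ((w s ^ 2) + (2 * v s)) * bx'))) - (11 * ((w' * u s + w s * u') * cx s + (w s * u s) * cx'))) + (((w' * wx s + w s * wx') + vx') * b s + ((w s * wx s) + vx s) * b')) - (2 * (((w' * ux s + w s * ux') + (4 * (u' * wx s + u s * wx'))) * c s + ((w s * ux s) + (4 * (u s * wx s))) * c'))) / 2 := by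
  have key := (((((((hu.fun_mul hax).const_mul 3).fun_add ((((hw.fun_pow 2).fun_add (hv.const_mul 2)).fun_mul hbx).const_mul 2)).fun_sub (((hw.fun_mul hu).fun_mul hcx).const_mul 11)).fun_add (((hw.fun_mul hwx).fun_add hvx).fun_mul hb)).fun_sub ((((hw.fun_mul hux).fun_add ((hu.fun_mul hwx).const_mul 4)).fun_mul hc).const_mul 2)).div_const 2)
  refine HasDerivAt.deriv ?_
  refine (key.congr_deriv ?_).congr_of_eventuallyEq (Filter.Eventually.of_forall fun s => ?_)
  · push_cast; ring
  · simp only []; ring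

lemma deriv_phi_v {w u v a b c wx ux vx ax bx cx : ℝ → ℝ} {w' u' v' a' b' c' wx' ux' vx' ax' bx' cx' s : ℝ}
    (hw : HasDerivAt w w' s)
    (hu : HasDerivAt u u' s)
    (hv : HasDerivAt v v' s)
    (ha : HasDerivAt a a' s)
    (hb : HasDerivAt b b' s)
    (hc : HasDerivAt c c' s)
    (hwx : HasDerivAt wx wx' s)
    (hux : HasDerivAt ux ux' s)
    (hvx : HasDerivAt vx vx' s)
    (hax : HasDerivAt ax ax' s)
    (hbx : HasDerivAt bx bx' s)
    (hcx : HasDerivAt cx cx' s) :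
    deriv (fun s => (4*v s*ax s-11*w s*u s*bx s-(6*w s^3+16*w s*v s+3*u s^2)*cx s+(-(3*w s*ux s)-u s*wx s)*b s-2*(3*w s^2*wx s+2*w s*vx s+u s*ux s+4*v s*wx s)*c s) / 2) s =
      (((((4 * (v' * ax s + v s * ax')) - (11 * ((w' * u s + w s * u') * bx s + (w s * u s) * bx'))) - ((((6 * (3 * (w s)^2 * w')) + (16 * (w' * v s + w s * v'))) + (3 * (2 * (u s)^1 * u'))) * cx s + (((6 * (w s ^ 3)) + (16 * (w s * v s))) + (3 * (u s ^ 2))) * cx')) + ((-((3 * (w' * ux s + w s * ux'))) - (u' * wx s + u s * wx')) * b s + (-((3 * (w s * ux s))) - (u s * wx s)) * b')) - (2 * (((((3 * ((2 * (w s)^1 * w') * wx s + (w s ^ 2) * wx')) + (2 * (w' * vx s + w s * vx'))) + (u' * ux s + u s * ux')) + (4 * (v' * wx s + v s * wx'))) * c s + ((((3 * ((w s ^ 2) * wx s)) + (2 * (w s * vx s))) + (u s * ux s)) + (4 * (v s * wx s))) * c'))) / 2 := by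
  have key := (((((((hv.fun_mul hax).const_mul 4).fun_sub (((hw.fun_mul hu).fun_mul hbx).const_mul 11)).fun_sub (((((hw.fun_pow 3).const_mul 6).fun_add ((hw.fun_mul hv).const_mul 16)).fun_add ((hu.fun_pow 2).const_mul 3)).fun_mul hcx)).fun_add ((((hw.fun_mul hux).const_mul 3).fun_neg.fun_sub (hu.fun_mul hwx)).fun_mul hb)).fun_sub ((((((((hw.fun_pow 2).fun_mul hwx).const_mul 3).fun_add ((hw.fun_mul hvx).const_mul 2)).fun_add (hu.fun_mul hux)).fun_add ((hv.fun_mul hwx).const_mul 4)).fun_mul hc).const_mul 2)).div_const 2)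
  refine HasDerivAt.deriv ?_
  refine (key.congr_deriv ?_).congr_of_eventuallyEq (Filter.Eventually.of_forall fun s => ?_)
  · push_cast; ring
  · simp only []; ring

/-- the operator `H₄,₁` maps cosymmetries of the dB equation
to symmetries. -/
theorem dB_H41_maps_cosym_to_sym (w u v ψw ψu ψv : ℝ → ℝ → ℝ)
    (hw : Smooth2 w) (hu : Smooth2 u) (hv : Smooth2 v)
    (hψw : Smooth2 ψw) (hψu : Smooth2 ψu) (hψv : Smooth2 ψv)
    (hsol : IsDBSolution w u v)
    (hψ : IsCosymmetryChar w u v ψw ψu ψv) :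
    IsSymmetryChar w u v
      (fun x t => (2 * w x t * pdx ψw x t + 3 * u x t * pdx ψu x t
        + 4 * v x t * pdx ψv x t + pdx u x t * ψu x t
        + 2 * pdx v x t * ψv x t) / 2)
      (fun x t => (3 * u x t * pdx ψw x t
        + 2 * ((w x t) ^ 2 + 2 * v x t) * pdx ψu x t
        - 11 * w x t * u x t * pdx ψv x t
        + (w x t * pdx w x t + pdx v x t) * ψu x t
        - 2 * (w x t * pdx u x t + 4 * u x t * pdx w x t) * ψv x t) / 2)
      (fun x t => (4 * v x t * pdx ψw x t
        - 11 * w x t * u x t * pdx ψu x t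
        - (6 * (w x t) ^ 3 + 16 * w x t * v x t + 3 * (u x t) ^ 2) * pdx ψv x t
        + (-(3 * w x t * pdx u x t) - u x t * pdx w x t) * ψu x t
        - 2 * (3 * (w x t) ^ 2 * pdx w x t + 2 * w x t * pdx v x t
          + u x t * pdx u x t + 4 * v x t * pdx w x t) * ψv x t) / 2) := by
  obtain ⟨e1, e2, e3⟩ := hsol
  obtain ⟨c1, c2, c3⟩ := hψ
  have mw : ∀ x t, pdt (pdx w) x t = pdx (pdx u) x t := by
    intro x t
    rw [pdt_pdx_comm hw]
    have h := (hasDerivAt_pdx (smooth_pdx hu) x t)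
    refine Eq.trans ?_ h.deriv
    exact congrArg (fun g => deriv g x) (funext fun y => e1 y t)
  have mu : ∀ x t, pdt (pdx u) x t = pdx w x t * pdx w x t + w x t * pdx (pdx w) x t + pdx (pdx v) x t := by
    intro x t
    rw [pdt_pdx_comm hu]
    have h := ((hasDerivAt_pdx hw x t).fun_mul (hasDerivAt_pdx (smooth_pdx hw) x t)).fun_add (hasDerivAt_pdx (smooth_pdx hv) x t)
    refine Eq.trans ?_ h.deriv
    exact congrArg (fun g => deriv g x) (funext fun y => e2 y t)
  have mv : ∀ x t, pdt (pdx v) x t = -(pdx u x t * pdx w x t + u x t * pdx (pdx w) x t) - (3 * pdx w x t * pdx u x t + 3 * w x t * pdx (pdx u) x t) := by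
    intro x t
    rw [pdt_pdx_comm hv]
    have h := ((hasDerivAt_pdx hu x t).fun_mul (hasDerivAt_pdx (smooth_pdx hw) x t)).fun_neg.fun_sub (((hasDerivAt_pdx hw x t).const_mul 3).fun_mul (hasDerivAt_pdx (smooth_pdx hu) x t))
    refine Eq.trans ?_ h.deriv
    exact congrArg (fun g => deriv g x) (funext fun y => e3 y t)
  have ma : ∀ x t, pdt (pdx ψw) x t = pdx w x t * pdx ψu x t + w x t * pdx (pdx ψu) x t - (pdx u x t * pdx ψv x t + u x t * pdx (pdx ψv) x t) + (2 * pdx (pdx u) x t * ψv x t + 2 * pdx u x t * pdx ψv x t) := by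
    intro x t
    rw [pdt_pdx_comm hψw]
    have h := (((hasDerivAt_pdx hw x t).fun_mul (hasDerivAt_pdx (smooth_pdx hψu) x t)).fun_sub ((hasDerivAt_pdx hu x t).fun_mul (hasDerivAt_pdx (smooth_pdx hψv) x t))).fun_add (((hasDerivAt_pdx (smooth_pdx hu) x t).const_mul 2).fun_mul (hasDerivAt_pdx hψv x t))
    refine Eq.trans ?_ h.deriv
    exact congrArg (fun g => deriv g x) (funext fun y => c1 y t)
  have mb : ∀ x t, pdt (pdx ψu) x t = pdx (pdx ψw) x t - (3 * pdx w x t * pdx ψv x t + 3 * w x t * pdx (pdx ψv) x t) - (2 * pdx (pdx w) x t * ψv x t + 2 * pdx w x t * pdx ψv x t) := by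
    intro x t
    rw [pdt_pdx_comm hψu]
    have h := ((hasDerivAt_pdx (smooth_pdx hψw) x t).fun_sub (((hasDerivAt_pdx hw x t).const_mul 3).fun_mul (hasDerivAt_pdx (smooth_pdx hψv) x t))).fun_sub (((hasDerivAt_pdx (smooth_pdx hw) x t).const_mul 2).fun_mul (hasDerivAt_pdx hψv x t))
    refine Eq.trans ?_ h.deriv
    exact congrArg (fun g => deriv g x) (funext fun y => c2 y t)
  have mc : ∀ x t, pdt (pdx ψv) x t = pdx (pdx ψu) x t := by
    intro x t
    rw [pdt_pdx_comm hψv]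
    have h := (hasDerivAt_pdx (smooth_pdx hψu) x t)
    refine Eq.trans ?_ h.deriv
    exact congrArg (fun g => deriv g x) (funext fun y => c3 y t)
  have dxw := fun x t => deriv_phi_w (hasDerivAt_pdx hw x t) (hasDerivAt_pdx hu x t) (hasDerivAt_pdx hv x t) (hasDerivAt_pdx hψw x t) (hasDerivAt_pdx hψu x t) (hasDerivAt_pdx hψv x t) (hasDerivAt_pdx (smooth_pdx hw) x t) (hasDerivAt_pdx (smooth_pdx hu) x t) (hasDerivAt_pdx (smooth_pdx hv) x t) (hasDerivAt_pdx (smooth_pdx hψw) x t) (hasDerivAt_pdx (smooth_pdx hψu) x t) (hasDerivAt_pdx (smooth_pdx hψv) x t)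
  have dtw := fun x t => deriv_phi_w (hasDerivAt_pdt hw x t) (hasDerivAt_pdt hu x t) (hasDerivAt_pdt hv x t) (hasDerivAt_pdt hψw x t) (hasDerivAt_pdt hψu x t) (hasDerivAt_pdt hψv x t) (hasDerivAt_pdt (smooth_pdx hw) x t) (hasDerivAt_pdt (smooth_pdx hu) x t) (hasDerivAt_pdt (smooth_pdx hv) x t) (hasDerivAt_pdt (smooth_pdx hψw) x t) (hasDerivAt_pdt (smooth_pdx hψu) x t) (hasDerivAt_pdt (smooth_pdx hψv) x t)
  have dxu := fun x t => deriv_phi_u (hasDerivAt_pdx hw x t) (hasDerivAt_pdx hu x t) (hasDerivAt_pdx hv x t) (hasDerivAt_pdx hψw x t) (hasDerivAt_pdx hψu x t) (hasDerivAt_pdx hψv x t) (hasDerivAt_pdx (smooth_pdx hw) x t) (hasDerivAt_pdx (smooth_pdx hu) x t) (hasDerivAt_pdx (smooth_pdx hv) x t) (hasDerivAt_pdx (smooth_pdx hψw) x t) (hasDerivAt_pdx (smooth_pdx hψu) x t) (hasDerivAt_pdx (smooth_pdx hψv) x t)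
  have dtu := fun x t => deriv_phi_u (hasDerivAt_pdt hw x t) (hasDerivAt_pdt hu x t) (hasDerivAt_pdt hv x t) (hasDerivAt_pdt hψw x t) (hasDerivAt_pdt hψu x t) (hasDerivAt_pdt hψv x t) (hasDerivAt_pdt (smooth_pdx hw) x t) (hasDerivAt_pdt (smooth_pdx hu) x t) (hasDerivAt_pdt (smooth_pdx hv) x t) (hasDerivAt_pdt (smooth_pdx hψw) x t) (hasDerivAt_pdt (smooth_pdx hψu) x t) (hasDerivAt_pdt (smooth_pdx hψv) x t)
  have dxv := fun x t => deriv_phi_v (hasDerivAt_pdx hw x t) (hasDerivAt_pdx hu x t) (hasDerivAt_pdx hv x t) (hasDerivAt_pdx hψw x t) (hasDerivAt_pdx hψu x t) (hasDerivAt_pdx hψv x t) (hasDerivAt_pdx (smooth_pdx hw) x t) (hasDerivAt_pdx (smooth_pdx hu) x t) (hasDerivAt_pdx (smooth_pdx hv) x t) (hasDerivAt_pdx (smooth_pdx hψw) x t) (hasDerivAt_pdx (smooth_pdx hψu) x t) (hasDerivAt_pdx (smooth_pdx hψv) x t)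
  have dtv := fun x t => deriv_phi_v (hasDerivAt_pdt hw x t) (hasDerivAt_pdt hu x t) (hasDerivAt_pdt hv x t) (hasDerivAt_pdt hψw x t) (hasDerivAt_pdt hψu x t) (hasDerivAt_pdt hψv x t) (hasDerivAt_pdt (smooth_pdx hw) x t) (hasDerivAt_pdt (smooth_pdx hu) x t) (hasDerivAt_pdt (smooth_pdx hv) x t) (hasDerivAt_pdt (smooth_pdx hψw) x t) (hasDerivAt_pdt (smooth_pdx hψu) x t) (hasDerivAt_pdt (smooth_pdx hψv) x t)
  refine ⟨fun x t => ?_, fun x t => ?_, fun x t => ?_⟩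
  · refine (dtw x t).trans (Eq.trans ?_ (dxu x t).symm)
    simp only [mw, mu, mv, ma, mb, mc, e1, e2, e3, c1, c2, c3]
    ring
  · refine (dtu x t).trans (Eq.trans ?_ (congrArg₂ (fun p q => w x t * p + pdx w x t * _ + q)
      (dxw x t) (dxv x t)).symm)
    simp only [mw, mu, mv, ma, mb, mc, e1, e2, e3, c1, c2, c3]
    ring
  · refine (dtv x t).trans (Eq.trans ?_ (congrArg₂ (fun p q => -(u x t * p) - 3 * pdx u x t * _
      - 3 * w x t * q - pdx w x t * _) (dxw x t) (dxu x t)).symm)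
    simp only [mw, mu, mv, ma, mb, mc, e1, e2, e3, c1, c2, c3]
    ring
end

section
/- The symmetry characteristics φ₃ and φ₅ of the dB equation commute: with φ₃ = (2w₁w + v₁, −w₁u − u₁w, −3w₁w² − u₁u − 2v₁w) and φ₅ = (w₁(v + 3w²) + u₁u + v₁w, u₁v + v₁u, w₁(−u² − 3w³) − 4u₁uw + v₁(v − w²)) regarded as polynomial triples in the variables (w,u,v,w₁,u₁,v₁), the Jacobi bracket {φ₃, φ₅} vanishes identically, i.e. all three components of {φ₃, φ₅} are the zero polynomial in (w,u,v,w₁,u₁,v₁,w₂,u₂,v₂). -/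
open MvPolynomial

noncomputable section

/-- The polynomial ring in the nine commuting variables
`w, u, v, w₁, u₁, v₁, w₂, u₂, v₂` over `ℝ`
(indexed `0,…,8` in that order). -/
abbrev JetPoly := MvPolynomial (Fin 9) ℝ

/-- The total derivative `D_x` on polynomials in `(w,u,v,w₁,u₁,v₁)`:
`D_x f = w₁·∂f/∂w + u₁·∂f/∂u + v₁·∂f/∂v + w₂·∂f/∂w₁ + u₂·∂f/∂u₁ + v₂·∂f/∂v₁`. -/
def Dx (f : JetPoly) : JetPoly :=
  X 3 * pderiv 0 f + X 4 * pderiv 1 f + X 5 * pderiv 2 f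
    + X 6 * pderiv 3 f + X 7 * pderiv 4 f + X 8 * pderiv 5 f

/-- The evolutionary action of a triple `φ` on a polynomial `f`:
`Σ_b (φ^b·∂f/∂b + D_x(φ^b)·∂f/∂b₁)` with `b` ranging over `{w,u,v}`. -/
def evAction (φ : Fin 3 → JetPoly) (f : JetPoly) : JetPoly :=
  φ 0 * pderiv 0 f + φ 1 * pderiv 1 f + φ 2 * pderiv 2 f
    + Dx (φ 0) * pderiv 3 f + Dx (φ 1) * pderiv 4 f + Dx (φ 2) * pderiv 5 f

/-- The Jacobi bracket of two triples of polynomials in `(w,u,v,w₁,u₁,v₁)`. -/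
def jacobiBracket (φ χ : Fin 3 → JetPoly) : Fin 3 → JetPoly :=
  fun a => evAction φ (χ a) - evAction χ (φ a)

/-- The symmetry `φ₃ = (2w₁w + v₁, −w₁u − u₁w, −3w₁w² − u₁u − 2v₁w)`. -/
def phi3 : Fin 3 → JetPoly :=
  ![2 * X 3 * X 0 + X 5,
    -(X 3 * X 1) - X 4 * X 0,
    -(3 * X 3 * X 0 ^ 2) - X 4 * X 1 - 2 * X 5 * X 0]

/-- The symmetry `φ₅ = (w₁(v + 3w²) + u₁u + v₁w, u₁v + v₁u,
w₁(−u² − 3w³) − 4u₁uw + v₁(v − w²))`. -/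
def phi5 : Fin 3 → JetPoly :=
  ![X 3 * (X 2 + 3 * X 0 ^ 2) + X 4 * X 1 + X 5 * X 0,
    X 4 * X 2 + X 5 * X 1,
    X 3 * (-(X 1 ^ 2) - 3 * X 0 ^ 3) - 4 * X 4 * X 1 * X 0
      + X 5 * (X 2 - X 0 ^ 2)]

/-- the symmetry characteristics `φ₃` and `φ₅` of the dB
equation commute: `{φ₃, φ₅} = 0` identically. -/
theorem dB_phi3_phi5_commute : ∀ a : Fin 3, jacobiBracket phi3 phi5 a = 0 := by
  have hn : ∀ (i : Fin 9) (n : ℕ) [n.AtLeastTwo],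
      pderiv i (OfNat.ofNat n : JetPoly) = 0 := by
    intro i n _
    exact (pderiv i).map_natCast n
  intro a
  fin_cases a <;>
    simp [jacobiBracket, evAction, Dx, phi3, phi5, pderiv_X, Pi.single_apply, hn,
      Derivation.leibniz, Derivation.leibniz_pow] <;>
    ring

end
end
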